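/- Let ℋ be a stable ordered-union ultrafilter on FIN and let T ⊆ FIN^{<ω} be an ℋ-tree. Then there exists f ∈ [T] such that {f(i) : i ∈ ω} ∈ FIN^[ω], f(i) <_b f(j) for all i < j < ω, and [{f(i) : i ∈ ω}] ∈ ℋ. -/

import Mathlib

open Set Filter

abbrev FIN : Type := {s : Finset ℕ // s.Nonempty}

def maxF (s : FIN) : ℕ := s.1.max' s.2

def minF (s : FIN) : ℕ := s.1.min' s.2

/-- `s <_b t` iff `max s < min t`. -/
def blt (s t : FIN) : Prop := maxF s < minF t

/-- An infinite block sequence, presented as its increasing enumeration. -/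
def IsBlockFun (X : ℕ → FIN) : Prop := ∀ i j : ℕ, i < j → blt (X i) (X j)

/-- A block sequence of length `n`. -/
def IsBlockSeqN {n : ℕ} (X : Fin n → FIN) : Prop :=
  ∀ i j : Fin n, i < j → blt (X i) (X j)

/-- `[X]` : all unions of finitely many (at least one) members of `X`. -/
def blocks (X : ℕ → FIN) : Set FIN :=
  {s | ∃ F : Finset ℕ, F.Nonempty ∧ s.1 = F.sup fun i => (X i).1}

def IsOrderedUnion (H : Ultrafilter FIN) : Prop :=
  ∀ A : Set FIN, A ∈ H →
    ∃ X : ℕ → FIN, IsBlockFun X ∧ blocks X ∈ H ∧ blocks X ⊆ A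

def IsStableOU (H : Ultrafilter FIN) : Prop :=
  IsOrderedUnion H ∧
    ∀ Xs : ℕ → ℕ → FIN, (∀ n, IsBlockFun (Xs n) ∧ blocks (Xs n) ∈ H) →
      ∃ Y : ℕ → FIN, IsBlockFun Y ∧ blocks Y ∈ H ∧
        ∀ n, ∀ᶠ i in atTop, Y i ∈ blocks (Xs n)

def IsSelective (U : Ultrafilter ℕ) : Prop :=
  ∀ f : ℕ → ℕ, ∃ A : Set ℕ, A ∈ U ∧
    ((∀ x ∈ A, ∀ y ∈ A, f x = f y) ∨ Set.InjOn f A)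

/-- `I(s) = {k : min s ≤ k ≤ max s}`. -/
def Iset (s : FIN) : Set ℕ := Set.Icc (minF s) (maxF s)

/-- `N(X) = ⋃ i, I(X(i))`. -/
def Nset (X : ℕ → FIN) : Set ℕ := ⋃ i, Iset (X i)

/-- Membership in the class `𝒞₀(ℋ)`. -/
def MemC0 (H : Ultrafilter FIN) (U : Ultrafilter ℕ) : Prop :=
  IsSelective U ∧
    ∀ X : ℕ → FIN, IsBlockFun X → blocks X ∈ H →
      ∃ Y : ℕ → FIN, IsBlockFun Y ∧ blocks Y ∈ H ∧ blocks Y ⊆ blocks X ∧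
        Nset Y ∉ U

def RKle (U V : Ultrafilter ℕ) : Prop := ∃ f : ℕ → ℕ, Ultrafilter.map f V = U

def RKequiv (U V : Ultrafilter ℕ) : Prop := RKle U V ∧ RKle V U

/-- Membership in the class `𝒞₁(ℋ)`. -/
def MemC1 (H : Ultrafilter FIN) (U : Ultrafilter ℕ) : Prop :=
  IsSelective U ∧
    ∀ V : Ultrafilter ℕ, IsSelective V → ¬ MemC0 H V → ¬ RKequiv U V

def initSeg {α : Type _} (f : ℕ → α) (n : ℕ) : List α := (List.range n).map f

def interleave (a : ℕ → ℕ) (b : ℕ → FIN) (m : ℕ) : ℕ ⊕ FIN :=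
  if m % 2 = 0 then Sum.inl (a (m / 2)) else Sum.inr (b (m / 2))

/-- Nodes of the tree `𝕋`: a node of length `l` is a sequence whose `k`-th entry
codes a function `𝒫(k) → 2` (coded as a total function `Finset ℕ → Bool`;
only values on subsets of `{0,…,k−1}` matter). -/
abbrev Node : Type := List (Finset ℕ → Bool)

/-- `s⁻ = s \ {max s}`. -/
def sm (s : FIN) : Finset ℕ := s.1.erase (maxF s)

/-- `A` is `(k,s)`-big. -/
def IsBig (k : ℕ) (s : FIN) (A : Set (Finset ℕ → Bool)) : Prop :=
  ∀ σ : Finset ℕ → Bool, ∃ τ ∈ A, ∀ u ⊆ Finset.range k, σ u = τ (u ∪ sm s)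

def succT (T : Set Node) (f : Node) : Set (Finset ℕ → Bool) := {τ | f ++ [τ] ∈ T}

/-- `H_{p,k}`. -/
def Hset (T : Set Node) (k : ℕ) : Set FIN :=
  {s | k ≤ maxF s ∧ ∀ f ∈ T, f.length = maxF s → IsBig k s (succT T f)}

/-- `T` is an `ℋ`-condition, i.e. a member of `ℙ(ℋ)`. -/
def IsCond (H : Ultrafilter FIN) (T : Set Node) : Prop :=
  (∀ g ∈ T, ∀ n, g.take n ∈ T) ∧ ([] : Node) ∈ T ∧
    (∀ f ∈ T, ∀ n : ℕ, f.length ≤ n → ∃ g ∈ T, f <+: g ∧ n ≤ g.length) ∧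
    ∀ k : ℕ, Hset T k ∈ H

/-- `T⟨f⟩`. -/
def Tsub (T : Set Node) (f : Node) : Set Node := {g ∈ T | f <+: g ∨ g <+: f}

/-- The constraint linking consecutive moves of Player I in `Γ^Cond(ℋ)`. -/
def StepOK (H : Ultrafilter FIN) (p : Set Node) (s : FIN) (p' : Set Node) : Prop :=
  ∃ q : Node → Set Node,
    (∀ e ∈ p, e.length = maxF s + 1 → IsCond H (q e) ∧ q e ⊆ Tsub p e) ∧
    p' = ⋃ e ∈ {e : Node | e ∈ p ∧ e.length = maxF s + 1}, q e

open Classical in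
/-- number of `a ∈ s` followed by a big gap (or by nothing) -/
noncomputable def gapCount (h : ℕ → ℕ) (s : Finset ℕ) : ℕ :=
  (s.filter fun a => ∀ b ∈ s, a < b → h a < b).card

theorem minF_le (s : FIN) {a : ℕ} (ha : a ∈ s.1) : minF s ≤ a := Finset.min'_le _ _ ha
theorem le_maxF (s : FIN) {a : ℕ} (ha : a ∈ s.1) : a ≤ maxF s := Finset.le_max' _ _ ha
theorem minF_mem (s : FIN) : minF s ∈ s.1 := Finset.min'_mem _ _
theorem maxF_mem (s : FIN) : maxF s ∈ s.1 := Finset.max'_mem _ _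
theorem minF_le_maxF (s : FIN) : minF s ≤ maxF s := minF_le s (maxF_mem s)

theorem gapCount_big (h : ℕ → ℕ) (s t : FIN) (hst : blt s t) (hb : h (maxF s) < minF t) :
    gapCount h (s.1 ∪ t.1) = gapCount h s.1 + gapCount h t.1 := by
  classical
  unfold gapCount
  have hlt : ∀ a ∈ s.1, ∀ b ∈ t.1, a < b := fun a ha b hb =>
    lt_of_le_of_lt (le_maxF s ha) (lt_of_lt_of_le hst (minF_le t hb))
  rw [← Finset.card_union_of_disjoint]
  · congr 1
    ext a
    simp only [Finset.mem_filter, Finset.mem_union]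
    constructor
    · rintro ⟨ha | ha, H⟩
      · exact Or.inl ⟨ha, fun b hb => H b (Or.inl hb)⟩
      · exact Or.inr ⟨ha, fun b hb => H b (Or.inr hb)⟩
    · rintro (⟨ha, H⟩ | ⟨ha, H⟩)
      · refine ⟨Or.inl ha, ?_⟩
        rintro b (hb' | hb') hab
        · exact H b hb' hab
        · rcases (le_maxF s ha).eq_or_lt with e | e
          · rw [e]; exact lt_of_lt_of_le hb (minF_le t hb')
          · exact (H _ (maxF_mem s) e).trans (hlt _ (maxF_mem s) _ hb')
      · refine ⟨Or.inr ha, ?_⟩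
        rintro b (hb' | hb') hab
        · exact absurd (hlt _ hb' _ ha) (by omega)
        · exact H b hb' hab
  · rw [Finset.disjoint_left]
    intro a h1 h2
    exact lt_irrefl _ (hlt a (Finset.mem_filter.1 h1).1 a (Finset.mem_filter.1 h2).1)

theorem gapCount_small (h : ℕ → ℕ) (s t : FIN) (hst : blt s t) (hb : ¬ h (maxF s) < minF t) :
    gapCount h (s.1 ∪ t.1) + 1 = gapCount h s.1 + gapCount h t.1 := by
  classical
  unfold gapCount
  have hlt : ∀ a ∈ s.1, ∀ b ∈ t.1, a < b := fun a ha b hb =>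
    lt_of_le_of_lt (le_maxF s ha) (lt_of_lt_of_le hst (minF_le t hb))
  have hn : maxF s ∉ (s.1 ∪ t.1).filter fun a => ∀ b ∈ s.1 ∪ t.1, a < b → h a < b := by
    intro hm
    exact hb ((Finset.mem_filter.1 hm).2 _ (Finset.mem_union_right _ (minF_mem t)) hst)
  rw [← Finset.card_union_of_disjoint, ← Finset.card_insert_of_notMem hn]
  · congr 1
    ext a
    simp only [Finset.mem_filter, Finset.mem_union, Finset.mem_insert]
    constructor
    · rintro (rfl | ⟨ha | ha, H⟩)
      · exact Or.inl ⟨maxF_mem s, fun b hb hab => absurd (le_maxF s hb) (by omega)⟩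
      · exact Or.inl ⟨ha, fun b hb => H b (Or.inl hb)⟩
      · exact Or.inr ⟨ha, fun b hb => H b (Or.inr hb)⟩
    · rintro (⟨ha, H⟩ | ⟨ha, H⟩)
      · rcases (le_maxF s ha).eq_or_lt with e | e
        · exact Or.inl e
        refine Or.inr ⟨Or.inl ha, ?_⟩
        rintro b (hb' | hb') hab
        · exact H b hb' hab
        · exact (H _ (maxF_mem s) e).trans (hlt _ (maxF_mem s) _ hb')
      · refine Or.inr ⟨Or.inr ha, ?_⟩
        rintro b (hb' | hb') hab
        · exact absurd (hlt _ hb' _ ha) (by omega)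
        · exact H b hb' hab
  · rw [Finset.disjoint_left]
    intro a h1 h2
    exact lt_irrefl _ (hlt a (Finset.mem_filter.1 h1).1 a (Finset.mem_filter.1 h2).1)

theorem IsBlockFun.strictMono_min {X : ℕ → FIN} (hX : IsBlockFun X) :
    StrictMono fun i => minF (X i) := fun i j hij =>
  lt_of_le_of_lt (minF_le_maxF _) (hX i j hij)

theorem IsBlockFun.strictMono_max {X : ℕ → FIN} (hX : IsBlockFun X) :
    StrictMono fun i => maxF (X i) := fun i j hij =>
  lt_of_lt_of_le (hX i j hij) (minF_le_maxF _)

theorem mem_blocks_self (X : ℕ → FIN) (i : ℕ) : X i ∈ blocks X :=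
  ⟨{i}, by simp, by simp⟩

theorem union_mem_blocks (X : ℕ → FIN) (i j : ℕ) :
    (⟨(X i).1 ∪ (X j).1, (X i).2.mono Finset.subset_union_left⟩ : FIN) ∈ blocks X :=
  ⟨{i, j}, by simp, by simp⟩

theorem exists_sparse (H : Ultrafilter FIN) (hH : IsOrderedUnion H) (h : ℕ → ℕ)
    (A : Set FIN) (hA : A ∈ H) :
    ∃ X : ℕ → FIN, IsBlockFun X ∧ blocks X ∈ H ∧ blocks X ⊆ A ∧
      ∀ i, h (maxF (X i)) < minF (X (i + 1)) := by
  rcases Ultrafilter.mem_or_compl_mem H {s : FIN | Even (gapCount h s.1)} with hC | hC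
  · obtain ⟨X, hX, hXH, hXA⟩ := hH _ (Filter.inter_mem hA hC)
    refine ⟨X, hX, hXH, fun s hs => (hXA hs).1, fun i => ?_⟩
    by_contra hb
    have h1 := gapCount_small h _ _ (hX i (i+1) (Nat.lt_succ_self i)) hb
    have e1 : Even (gapCount h (X i).1) := (hXA (mem_blocks_self X i)).2
    have e2 : Even (gapCount h (X (i+1)).1) := (hXA (mem_blocks_self X (i+1))).2
    have e3 : Even (gapCount h ((X i).1 ∪ (X (i+1)).1)) := (hXA (union_mem_blocks X i (i+1))).2
    grind
  · obtain ⟨X, hX, hXH, hXA⟩ := hH _ (Filter.inter_mem hA hC)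
    exfalso
    have hj := hX.strictMono_min.le_apply (x := h (maxF (X 0)) + 1)
    set j := h (maxF (X 0)) + 1 with hjd
    have hb : h (maxF (X 0)) < minF (X j) := by omega
    have h1 := gapCount_big h _ _ (hX 0 j (by omega)) hb
    have e1 : ¬ Even (gapCount h (X 0).1) := (hXA (mem_blocks_self X 0)).2
    have e2 : ¬ Even (gapCount h (X j).1) := (hXA (mem_blocks_self X j)).2
    have e3 : ¬ Even (gapCount h ((X 0).1 ∪ (X j).1)) := (hXA (union_mem_blocks X 0 j)).2
    rw [h1, Nat.even_add] at e3
    tauto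

theorem blocks_closed (X : ℕ → FIN) (Y : ℕ → FIN) (F : Finset ℕ) (hF : F.Nonempty)
    (hY : ∀ i ∈ F, Y i ∈ blocks X) (s : FIN) (hs : s.1 = F.sup fun i => (Y i).1) :
    s ∈ blocks X := by
  classical
  have : ∀ i, ∃ G : Finset ℕ, i ∈ F → G.Nonempty ∧ (Y i).1 = G.sup fun i => (X i).1 := by
    intro i
    by_cases hi : i ∈ F
    · obtain ⟨G, h⟩ := hY i hi
      exact ⟨G, fun _ => h⟩
    · exact ⟨∅, fun h => absurd h hi⟩
  choose G hG using this
  refine ⟨F.biUnion G, ?_, ?_⟩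
  · obtain ⟨i, hi⟩ := hF
    obtain ⟨k, hk⟩ := (hG i hi).1
    exact ⟨k, Finset.mem_biUnion.2 ⟨i, hi, hk⟩⟩
  · rw [hs, Finset.sup_biUnion]
    exact Finset.sup_congr rfl fun i hi => (hG i hi).2

theorem finite_nodes (m : ℕ) :
    {l : List FIN | l.length ≤ m + 1 ∧ ∀ x ∈ l, maxF x ≤ m}.Finite := by
  have hS : {x : FIN | maxF x ≤ m}.Finite := by
    refine Set.Finite.of_finite_image (f := Subtype.val) ?_ Subtype.val_injective.injOn
    refine (Finset.finite_toSet (Finset.range (m+1)).powerset).subset ?_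
    rintro _ ⟨x, hx, rfl⟩
    simp only [Finset.coe_powerset, Set.mem_preimage, Set.mem_powerset_iff]
    intro a ha
    have := le_maxF x ha
    replace hx : maxF x ≤ m := hx
    simp; omega
  have := hS.to_subtype
  refine ((List.finite_length_le {x : FIN | maxF x ≤ m} (m+1)).image
    (List.map Subtype.val)).subset ?_
  rintro l ⟨hl, hx⟩
  lift l to List {x : FIN | maxF x ≤ m} using hx
  exact ⟨l, (by simpa using hl : l.length ≤ m + 1), rfl⟩

/-- every `ℋ`-tree has a branch which is a block sequence whose
`[·]` belongs to `ℋ`. -/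
theorem stmt3 (H : Ultrafilter FIN) (hH : IsStableOU H)
    (T : Set (List FIN))
    (hsub : ∀ g ∈ T, ∀ n, g.take n ∈ T)
    (hnil : ([] : List FIN) ∈ T)
    (hsucc : ∀ σ ∈ T, {s : FIN | σ ++ [s] ∈ T} ∈ H) :
    ∃ f : ℕ → FIN, (∀ n, initSeg f n ∈ T) ∧ IsBlockFun f ∧ blocks f ∈ H := by
  have hA : ∀ m : ℕ, {s : FIN | ∀ σ ∈ {l : List FIN | l.length ≤ m + 1 ∧ ∀ x ∈ l, maxF x ≤ m},
      σ ∈ T → σ ++ [s] ∈ T} ∈ H := by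
    intro m
    have := (Filter.biInter_mem (f := (H : Filter FIN)) (finite_nodes m)
      (s := fun σ => {s : FIN | σ ∈ T → σ ++ [s] ∈ T})).2 (by
        intro σ _
        by_cases hσ : σ ∈ T
        · simpa [hσ] using hsucc σ hσ
        · simp [hσ])
    refine Filter.mem_of_superset this ?_
    intro s hs σ h1
    exact Set.mem_iInter₂.1 hs σ h1
  choose Xs hXs using fun m => hH.1 _ (hA m)
  obtain ⟨Y, hY, hYH, hYX⟩ := hH.2 Xs fun n => ⟨(hXs n).1, (hXs n).2.1⟩
  simp only [Filter.eventually_atTop] at hYX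
  choose g hg using hYX
  obtain ⟨Z, hZ, hZH, hZA, hZs⟩ := exists_sparse H hH.1 (fun m => maxF (Y (g m))) _
    (Filter.inter_mem hYH (hsucc [] hnil))
  refine ⟨Z, ?_, hZ, hZH⟩
  intro n
  induction n with
  | zero => simpa [initSeg] using hnil
  | succ n ih =>
    have e : initSeg Z (n+1) = initSeg Z n ++ [Z n] := by
      simp [initSeg, List.range_succ]
    rw [e]
    cases n with
    | zero => exact (hZA (mem_blocks_self Z 0)).2
    | succ i =>
      set m := maxF (Z i) with hm
      have hmem : Z (i+1) ∈ blocks (Xs m) := by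
        obtain ⟨F, hF, hFs⟩ := (hZA (mem_blocks_self Z (i+1))).1
        refine blocks_closed _ Y F hF (fun j hj => hg m j ?_) _ hFs
        by_contra hlt
        have h1 : maxF (Y j) ≤ maxF (Y (g m)) := hY.strictMono_max.monotone (by omega)
        have h2 : minF (Y j) ∈ (Z (i+1)).1 := by
          rw [hFs]
          exact Finset.mem_of_subset (Finset.le_sup (f := fun i => (Y i).1) hj) (minF_mem _)
        have h3 := minF_le _ h2
        have h4 := hZs i
        have h5 := minF_le_maxF (Y j)
        simp only [← hm] at h4
        omega
      refine (hXs m).2.2 hmem _ ⟨?_, ?_⟩ ih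
      · have := hZ.strictMono_max.le_apply (x := i)
        simp only [← hm] at this
        simp [initSeg]; omega
      · intro x hx
        simp only [initSeg, List.mem_map, List.mem_range] at hx
        obtain ⟨a, ha, rfl⟩ := hx
        exact hZ.strictMono_max.monotone (by omega)
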